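/- arXiv:1412.8447 — 6 statements merged into one kernel-verified Lean document; each statement's English description precedes it below -/
import Mathlib

section
/- Let A be an m×n complex matrix, C an m×k complex matrix, V an n×k complex matrix, R a k×n complex matrix, and E, Ẽ, W matrices such that A = C Vᴴ + E and A = W R + Ẽ. Suppose B is an n×k complex matrix satisfying R B R = R and (B R)ᴴ = B R (so that B plays the role of the Moore–Penrose pseudoinverse R† in the product R† R). Define U := Vᴴ B. Then, in the spectral (L2 operator) norm, ‖A − C U R‖ ≤ ‖E‖ + ‖Ẽ‖. -/
open Matrix
open scoped Matrix.Norms.L2Operator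

/-- Lemma 1 of the paper: if `A = C Vᴴ + E` and `A = W R + Ẽ`, and `B` plays the role of the
Moore–Penrose pseudoinverse `R†` (satisfying the Penrose conditions `R B R = R` and
`(B R)ᴴ = B R`), then with `U := Vᴴ B` we have `‖A − C U R‖ ≤ ‖E‖ + ‖Ẽ‖` in the
spectral (L2 operator) norm. -/
theorem cur_error_bound {m n k : ℕ}
    (A E Etilde : Matrix (Fin m) (Fin n) ℂ)
    (C W : Matrix (Fin m) (Fin k) ℂ)
    (V B : Matrix (Fin n) (Fin k) ℂ)
    (R : Matrix (Fin k) (Fin n) ℂ)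
    (hE : A = C * Vᴴ + E)
    (hEtilde : A = W * R + Etilde)
    (hB1 : R * B * R = R)
    (hB2 : (B * R)ᴴ = B * R)
    (U : Matrix (Fin k) (Fin k) ℂ) (hU : U = Vᴴ * B) :
    ‖A - C * U * R‖ ≤ ‖E‖ + ‖Etilde‖ := by
  have hP : IsStarProjection (B * R) := by
    refine ⟨?_, hB2⟩
    change B * R * (B * R) = B * R
    rw [Matrix.mul_assoc, ← Matrix.mul_assoc R, hB1]
  have h1 : ‖B * R‖ ≤ 1 := hP.norm_le
  have h2 : ‖1 - B * R‖ ≤ 1 := hP.one_sub.norm_le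
  have hR : W * R * (B * R) = W * R := by
    rw [Matrix.mul_assoc, ← Matrix.mul_assoc R, hB1]
  have hC : C * U * R = (A - E) * (B * R) := by
    have hAE : A - E = C * Vᴴ := by rw [hE, add_sub_cancel_right]
    rw [hAE, hU]
    simp only [Matrix.mul_assoc]
  have hA : A - A * (B * R) = Etilde * (1 - B * R) := by
    rw [hEtilde, Matrix.add_mul, hR, Matrix.mul_sub, Matrix.mul_one]
    abel
  have key : A - C * U * R = E * (B * R) + Etilde * (1 - B * R) := by
    rw [← hA, hC, Matrix.sub_mul]
    abel
  rw [key]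
  refine (norm_add_le _ _).trans (add_le_add ?_ ?_)
  · exact (Matrix.l2_opNorm_mul _ _).trans (mul_le_of_le_one_right (norm_nonneg _) h1)
  · exact (Matrix.l2_opNorm_mul _ _).trans (mul_le_of_le_one_right (norm_nonneg _) h2)
end

section
/- Let k ≤ m and write every m×n complex matrix in block-row form with a top block of k rows and a bottom block of m−k rows. Let A be an m×n complex matrix, C an m×k complex matrix, V an n×k complex matrix, and E a matrix with A = C Vᴴ + E. Let P be an m×m permutation matrix, T a k×(m−k) complex matrix, and suppose C = W · C₁, where W := P · [I_k ; Tᴴ] (the m×k matrix obtained by stacking the k×k identity on top of Tᴴ and multiplying by P on the left) and C₁ := (Pᴴ C)(1:k, :) is the top k×k block of Pᴴ C. Define R := (Pᴴ A)(1:k, :), the top k×n block of Pᴴ A, and F := [−Tᴴ I_{m−k}] · Pᴴ (an (m−k)×m matrix). Then A − W R = P · [0 ; F E], the m×n matrix whose top k rows are zero and whose bottom m−k rows equal F E. -/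
open Matrix

/-- Lemma 2 of the paper. Rows of an `m × n` matrix are modelled by the index type
`Fin k ⊕ Fin (m - k)` (top block of `k` rows, bottom block of `m - k` rows), with `k ≤ m`.
If `A = C Vᴴ + E`, `P` is a permutation matrix, `W = P [I_k ; Tᴴ]`, `C = W C₁` with
`C₁` the top `k × k` block of `Pᴴ C`, `R` the top `k × n` block of `Pᴴ A`, and
`F = [−Tᴴ I] Pᴴ`, then the residual of the row interpolative decomposition satisfies
`A − W R = P [0 ; F E]`. -/
theorem row_id_residual {m n k : ℕ} (hk : k ≤ m)
    (A E : Matrix (Fin k ⊕ Fin (m - k)) (Fin n) ℂ)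
    (C : Matrix (Fin k ⊕ Fin (m - k)) (Fin k) ℂ)
    (V : Matrix (Fin n) (Fin k) ℂ)
    (hE : A = C * Vᴴ + E)
    (P : Matrix (Fin k ⊕ Fin (m - k)) (Fin k ⊕ Fin (m - k)) ℂ)
    (hP : ∃ σ : Equiv.Perm (Fin k ⊕ Fin (m - k)), P = σ.permMatrix ℂ)
    (T : Matrix (Fin k) (Fin (m - k)) ℂ)
    (W : Matrix (Fin k ⊕ Fin (m - k)) (Fin k) ℂ)
    (hW : W = P * fromRows (1 : Matrix (Fin k) (Fin k) ℂ) Tᴴ)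
    (hC : C = W * toRows₁ (Pᴴ * C))
    (R : Matrix (Fin k) (Fin n) ℂ)
    (hR : R = toRows₁ (Pᴴ * A))
    (F : Matrix (Fin (m - k)) (Fin k ⊕ Fin (m - k)) ℂ)
    (hF : F = fromCols (-Tᴴ) (1 : Matrix (Fin (m - k)) (Fin (m - k)) ℂ) * Pᴴ) :
    A - W * R = P * fromRows (0 : Matrix (Fin k) (Fin n) ℂ) (F * E) := by
  obtain ⟨σ, hσ⟩ := hP
  have h1 : Pᴴ = (σ⁻¹).permMatrix ℂ := by rw [hσ, Matrix.conjTranspose_permMatrix]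
  have hPP : P * Pᴴ = 1 := by
    rw [h1, hσ, ← Matrix.permMatrix_mul]; simp
  have hPP' : Pᴴ * P = 1 := by
    rw [h1, hσ, ← Matrix.permMatrix_mul]; simp
  have hFW : F * W = 0 := by
    rw [hF, hW, Matrix.mul_assoc, ← Matrix.mul_assoc Pᴴ, hPP', Matrix.one_mul,
      fromCols_mul_fromRows]
    simp
  have hFC : F * C = 0 := by
    rw [hC, ← Matrix.mul_assoc, hFW, Matrix.zero_mul]
  have hFA : F * E = F * A := by
    rw [hE, Matrix.mul_add, ← Matrix.mul_assoc, hFC, Matrix.zero_mul, zero_add]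
  have hA : A = P * (Pᴴ * A) := by
    rw [← Matrix.mul_assoc, hPP, Matrix.one_mul]
  have hFB : F * A = -Tᴴ * toRows₁ (Pᴴ * A) + toRows₂ (Pᴴ * A) := by
    rw [hF, Matrix.mul_assoc]
    conv_lhs => rw [← fromRows_toRows (Pᴴ * A)]
    rw [fromCols_mul_fromRows, Matrix.one_mul]
  rw [hFA, hFB, hR, hW, Matrix.mul_assoc]
  conv_lhs => enter [1]; rw [hA]
  rw [← Matrix.mul_sub, fromRows_mul, Matrix.one_mul]
  congr 1
  ext (i | i) j
  · simp [toRows₁]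
  · simp [toRows₂]
    ring
end

section
/- Let k ≤ m. Let A be an m×n complex matrix, C an m×k complex matrix, V an n×k complex matrix, and E a matrix with A = C Vᴴ + E. Let P be an m×m permutation matrix, T a k×(m−k) complex matrix, W := P · [I_k ; Tᴴ], F := [−Tᴴ I_{m−k}] · Pᴴ, R := (Pᴴ A)(1:k, :), and suppose C = W · (Pᴴ C)(1:k, :). Then the row-ID residual Ẽ := A − W R satisfies ‖Ẽ‖ ≤ (1 + ‖T‖) · ‖E‖ in the spectral (L2 operator) norm. -/
open Matrix
open scoped Matrix.Norms.L2Operator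

theorem isom_norm_le {a b : Type*} [Fintype a] [Fintype b] [DecidableEq a] [DecidableEq b]
    (M : Matrix a b ℂ) (h : Mᴴ * M = 1) : ‖M‖ ≤ 1 := by
  have h1 := l2_opNorm_conjTranspose_mul_self M
  have h2 : ‖(1 : Matrix b b ℂ)‖ ≤ 1 := by
    rw [← diagonal_one, l2_opNorm_diagonal]
    exact (pi_norm_le_iff_of_nonneg zero_le_one).2 (fun i => by simp)
  rw [h] at h1
  nlinarith [norm_nonneg M]

/-- First part of the Corollary to Lemma 2 of the paper: under the hypotheses of Lemma 2,
the row-ID residual `Ẽ = A − W R` satisfies `‖Ẽ‖ ≤ (1 + ‖T‖) ‖E‖` in the spectral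
(L2 operator) norm. -/
theorem row_id_error_bound {m n k : ℕ} (hk : k ≤ m)
    (A E : Matrix (Fin k ⊕ Fin (m - k)) (Fin n) ℂ)
    (C : Matrix (Fin k ⊕ Fin (m - k)) (Fin k) ℂ)
    (V : Matrix (Fin n) (Fin k) ℂ)
    (hE : A = C * Vᴴ + E)
    (P : Matrix (Fin k ⊕ Fin (m - k)) (Fin k ⊕ Fin (m - k)) ℂ)
    (hP : ∃ σ : Equiv.Perm (Fin k ⊕ Fin (m - k)), P = σ.permMatrix ℂ)
    (T : Matrix (Fin k) (Fin (m - k)) ℂ)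
    (W : Matrix (Fin k ⊕ Fin (m - k)) (Fin k) ℂ)
    (hW : W = P * fromRows (1 : Matrix (Fin k) (Fin k) ℂ) Tᴴ)
    (hC : C = W * toRows₁ (Pᴴ * C))
    (R : Matrix (Fin k) (Fin n) ℂ)
    (hR : R = toRows₁ (Pᴴ * A)) :
    ‖A - W * R‖ ≤ (1 + ‖T‖) * ‖E‖ := by
  obtain ⟨σ, hσ⟩ := hP
  have hPP : Pᴴ * P = 1 := by
    rw [hσ, conjTranspose_permMatrix, ← Matrix.permMatrix_mul]; simp
  have hPP' : P * Pᴴ = 1 := mul_eq_one_comm.1 hPP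
  have hPn : ‖P‖ ≤ 1 := isom_norm_le P hPP
  have hPn' : ‖Pᴴ‖ ≤ 1 := by rwa [l2_opNorm_conjTranspose]
  let J : Matrix (Fin k ⊕ Fin (m - k)) (Fin (m - k)) ℂ := fromRows 0 1
  let K : Matrix (Fin k ⊕ Fin (m - k)) (Fin k) ℂ := fromRows 1 0
  have hJ : ‖J‖ ≤ 1 := isom_norm_le J (by
    simp [J, conjTranspose_fromRows_eq_fromCols_conjTranspose, fromCols_mul_fromRows])
  have hK : ‖K‖ ≤ 1 := isom_norm_le K (by
    simp [K, conjTranspose_fromRows_eq_fromCols_conjTranspose, fromCols_mul_fromRows])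
  have htop : ∀ {l : ℕ} (X : Matrix (Fin k ⊕ Fin (m - k)) (Fin l) ℂ), toRows₁ X = Kᴴ * X := by
    intro l X
    conv_rhs => rw [← fromRows_toRows X]
    simp only [K, conjTranspose_fromRows_eq_fromCols_conjTranspose, fromCols_mul_fromRows]
    simp
  have hres : A - W * R = E - W * (Kᴴ * (Pᴴ * E)) := by
    rw [htop] at hC hR
    have h3 : W * (Kᴴ * (Pᴴ * (C * Vᴴ))) = C * Vᴴ := by
      conv_rhs => rw [hC]
      simp only [Matrix.mul_assoc]
    rw [hR, hE, Matrix.mul_add, Matrix.mul_add, Matrix.mul_add, h3]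
    abel
  have hkey : ∀ X : Matrix (Fin k ⊕ Fin (m - k)) (Fin n) ℂ,
      X - fromRows (1 : Matrix (Fin k) (Fin k) ℂ) Tᴴ * (Kᴴ * X)
        = J * (Jᴴ * X - Tᴴ * (Kᴴ * X)) := by
    intro X
    rw [← fromRows_toRows X]
    simp only [J, K, conjTranspose_fromRows_eq_fromCols_conjTranspose, fromCols_mul_fromRows,
      fromRows_mul]
    ext (i | i) j <;> simp
  have hfin : A - W * R = P * (J * (Jᴴ * (Pᴴ * E) - Tᴴ * (Kᴴ * (Pᴴ * E)))) := by
    rw [hres, ← hkey, Matrix.mul_sub, ← Matrix.mul_assoc P Pᴴ, hPP', Matrix.one_mul, hW,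
      Matrix.mul_assoc P]
  have contr : ∀ {a b : Type} [Fintype a] [Fintype b] [DecidableEq a] [DecidableEq b]
      (M : Matrix a b ℂ) (X : Matrix b (Fin n) ℂ), ‖M‖ ≤ 1 → ‖M * X‖ ≤ ‖X‖ := by
    intro a b _ _ _ _ M X hM
    exact (l2_opNorm_mul M X).trans (mul_le_of_le_one_left (norm_nonneg _) hM)
  have hX : ‖Pᴴ * E‖ ≤ ‖E‖ := contr _ _ hPn'
  have hJ' : ‖Jᴴ‖ ≤ 1 := by rwa [l2_opNorm_conjTranspose]
  have hK' : ‖Kᴴ‖ ≤ 1 := by rwa [l2_opNorm_conjTranspose]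
  have h5 : ‖Tᴴ * (Kᴴ * (Pᴴ * E))‖ ≤ ‖T‖ * ‖E‖ := by
    refine (l2_opNorm_mul _ _).trans ?_
    rw [l2_opNorm_conjTranspose]
    exact mul_le_mul_of_nonneg_left ((contr _ _ hK').trans hX) (norm_nonneg _)
  have h6 : ‖Jᴴ * (Pᴴ * E)‖ ≤ ‖E‖ := (contr _ _ hJ').trans hX
  rw [hfin]
  refine (contr _ _ hPn).trans ((contr _ _ hJ).trans ((norm_sub_le _ _).trans ?_))
  linarith
end

section
/- Let k ≤ m. Let A be an m×n complex matrix, C an m×k complex matrix, V an n×k complex matrix, and E a matrix with A = C Vᴴ + E. Let P be an m×m permutation matrix, T a k×(m−k) complex matrix, W := P · [I_k ; Tᴴ], R := (Pᴴ A)(1:k, :), and suppose C = W · (Pᴴ C)(1:k, :). Let B be an n×k complex matrix satisfying R B R = R and (B R)ᴴ = B R, and define U := Vᴴ B. Then ‖A − C U R‖ ≤ (2 + ‖T‖) · ‖E‖ in the spectral (L2 operator) norm. -/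
open Matrix
open scoped Matrix.Norms.L2Operator

lemma aux_proj {n : Type*} [Fintype n] [DecidableEq n] (Q : Matrix n n ℂ) (h : Qᴴ * Q = Q) :
    ‖Q‖ ≤ 1 := by
  have h1 := l2_opNorm_conjTranspose_mul_self Q
  rw [h] at h1
  by_contra! h2
  nlinarith

lemma aux_iso {m n : Type*} [Fintype m] [Fintype n] [DecidableEq m] [DecidableEq n]
    (M : Matrix m n ℂ) (h : Mᴴ * M = 1) : ‖M‖ ≤ 1 := by
  have h1 := l2_opNorm_conjTranspose_mul_self M
  have h0 : ‖(1 : Matrix n n ℂ)‖ ≤ 1 := aux_proj _ (by simp)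
  rw [h] at h1
  by_contra! h2
  nlinarith

lemma aux_mul {l m n : Type*} [Fintype l] [Fintype m] [Fintype n] [DecidableEq l]
    [DecidableEq m] [DecidableEq n] (M : Matrix l m ℂ) (N : Matrix m n ℂ) (h : ‖M‖ ≤ 1) :
    ‖M * N‖ ≤ ‖N‖ :=
  (l2_opNorm_mul M N).trans (mul_le_of_le_one_left (norm_nonneg _) h)

lemma aux_mul_right {l m n : Type*} [Fintype l] [Fintype m] [Fintype n] [DecidableEq l]
    [DecidableEq m] [DecidableEq n] (M : Matrix l m ℂ) (N : Matrix m n ℂ) (h : ‖N‖ ≤ 1) :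
    ‖M * N‖ ≤ ‖M‖ :=
  (l2_opNorm_mul M N).trans (mul_le_of_le_one_right (norm_nonneg _) h)

/-- Second part of the Corollary to Lemma 2 of the paper: under the hypotheses of Lemma 2,
with `B` satisfying the Penrose conditions `R B R = R` and `(B R)ᴴ = B R` (so `B` plays the
role of `R†`) and `U := Vᴴ B`, the CUR-ID error satisfies `‖A − C U R‖ ≤ (2 + ‖T‖) ‖E‖`
in the spectral (L2 operator) norm. -/
theorem cur_id_error_bound {m n k : ℕ} (hk : k ≤ m)
    (A E : Matrix (Fin k ⊕ Fin (m - k)) (Fin n) ℂ)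
    (C : Matrix (Fin k ⊕ Fin (m - k)) (Fin k) ℂ)
    (V : Matrix (Fin n) (Fin k) ℂ)
    (hE : A = C * Vᴴ + E)
    (P : Matrix (Fin k ⊕ Fin (m - k)) (Fin k ⊕ Fin (m - k)) ℂ)
    (hP : ∃ σ : Equiv.Perm (Fin k ⊕ Fin (m - k)), P = σ.permMatrix ℂ)
    (T : Matrix (Fin k) (Fin (m - k)) ℂ)
    (W : Matrix (Fin k ⊕ Fin (m - k)) (Fin k) ℂ)
    (hW : W = P * fromRows (1 : Matrix (Fin k) (Fin k) ℂ) Tᴴ)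
    (hC : C = W * toRows₁ (Pᴴ * C))
    (R : Matrix (Fin k) (Fin n) ℂ)
    (hR : R = toRows₁ (Pᴴ * A))
    (B : Matrix (Fin n) (Fin k) ℂ)
    (hB1 : R * B * R = R)
    (hB2 : (B * R)ᴴ = B * R)
    (U : Matrix (Fin k) (Fin k) ℂ) (hU : U = Vᴴ * B) :
    ‖A - C * U * R‖ ≤ (2 + ‖T‖) * ‖E‖ := by
  have hPP : Pᴴ * P = 1 ∧ P * Pᴴ = 1 := by
    obtain ⟨σ, rfl⟩ := hP
    constructor
    · rw [conjTranspose_permMatrix, ← permMatrix_mul]; simp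
    · rw [conjTranspose_permMatrix, ← permMatrix_mul]; simp
  obtain ⟨hP1, hP2⟩ := hPP
  have nP : ‖P‖ ≤ 1 := aux_iso P hP1
  have nPH : ‖Pᴴ‖ ≤ 1 := by rw [l2_opNorm_conjTranspose]; exact nP
  have hQ : (B * R)ᴴ * (B * R) = B * R := by
    rw [hB2, Matrix.mul_assoc, ← Matrix.mul_assoc R, hB1]
  have nQ : ‖B * R‖ ≤ 1 := aux_proj _ hQ
  have nQ' : ‖1 - B * R‖ ≤ 1 := by
    apply aux_proj
    rw [conjTranspose_sub, hB2, conjTranspose_one]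
    rw [hB2] at hQ
    rw [Matrix.mul_sub, Matrix.sub_mul, Matrix.sub_mul, hQ]
    simp
  have hRQ : R * (1 - B * R) = 0 := by
    rw [Matrix.mul_sub, ← Matrix.mul_assoc, hB1]; simp
  -- the matrix of the row interpolation error
  have hR' : R = toRows₁ (Pᴴ * C) * Vᴴ + toRows₁ (Pᴴ * E) := by
    rw [hR, hE, Matrix.mul_add, ← Matrix.mul_assoc]
    rfl
  have hA : A = W * R + (E - W * toRows₁ (Pᴴ * E)) := by
    rw [hR', Matrix.mul_add, ← Matrix.mul_assoc, ← hC, hE]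
    abel
  have hF : E - W * toRows₁ (Pᴴ * E) =
      P * (fromRows (0 : Matrix (Fin k) (Fin (m - k)) ℂ) (1 : Matrix (Fin (m - k)) (Fin (m - k)) ℂ) *
        (toRows₂ (Pᴴ * E) - Tᴴ * toRows₁ (Pᴴ * E))) := by
    have h1 : E = P * fromRows (toRows₁ (Pᴴ * E)) (toRows₂ (Pᴴ * E)) := by
      rw [fromRows_toRows, ← Matrix.mul_assoc, hP2, Matrix.one_mul]
    conv_lhs => enter [1]; rw [h1]
    rw [hW, Matrix.mul_assoc, ← Matrix.mul_sub, fromRows_mul, fromRows_mul]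
    congr 1
    ext (i | i) j <;> simp
  have nS0 : ‖fromRows (0 : Matrix (Fin k) (Fin (m - k)) ℂ) (1 : Matrix (Fin (m - k)) (Fin (m - k)) ℂ)‖ ≤ 1 := by
    apply aux_iso
    rw [conjTranspose_fromRows_eq_fromCols_conjTranspose, fromCols_mul_fromRows]
    simp
  have nS1 : ‖fromRows (1 : Matrix (Fin k) (Fin k) ℂ) (0 : Matrix (Fin (m - k)) (Fin k) ℂ)‖ ≤ 1 := by
    apply aux_iso
    rw [conjTranspose_fromRows_eq_fromCols_conjTranspose, fromCols_mul_fromRows]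
    simp
  have nPE : ‖Pᴴ * E‖ ≤ ‖E‖ := aux_mul _ _ nPH
  have n1 : ‖toRows₁ (Pᴴ * E)‖ ≤ ‖E‖ := by
    have : toRows₁ (Pᴴ * E) = (fromRows (1 : Matrix (Fin k) (Fin k) ℂ)
        (0 : Matrix (Fin (m - k)) (Fin k) ℂ))ᴴ * (Pᴴ * E) := by
      conv_rhs => rw [← fromRows_toRows (Pᴴ * E)]
      rw [conjTranspose_fromRows_eq_fromCols_conjTranspose, fromCols_mul_fromRows]
      simp
    rw [this]
    exact (aux_mul _ _ (by rw [l2_opNorm_conjTranspose]; exact nS1)).trans nPE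
  have n2 : ‖toRows₂ (Pᴴ * E)‖ ≤ ‖E‖ := by
    have : toRows₂ (Pᴴ * E) =
        (fromRows (0 : Matrix (Fin k) (Fin (m - k)) ℂ) (1 : Matrix (Fin (m - k)) (Fin (m - k)) ℂ))ᴴ * (Pᴴ * E) := by
      conv_rhs => rw [← fromRows_toRows (Pᴴ * E)]
      rw [conjTranspose_fromRows_eq_fromCols_conjTranspose, fromCols_mul_fromRows]
      simp
    rw [this]
    exact (aux_mul _ _ (by rw [l2_opNorm_conjTranspose]; exact nS0)).trans nPE
  have nF : ‖E - W * toRows₁ (Pᴴ * E)‖ ≤ (1 + ‖T‖) * ‖E‖ := by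
    rw [hF]
    refine (aux_mul _ _ nP).trans ((aux_mul _ _ nS0).trans ((norm_sub_le _ _).trans ?_))
    have h3 := l2_opNorm_mul Tᴴ (toRows₁ (Pᴴ * E))
    rw [l2_opNorm_conjTranspose] at h3
    have h4 := mul_le_mul_of_nonneg_left n1 (norm_nonneg T)
    linarith
  have key : A - C * U * R = (E - W * toRows₁ (Pᴴ * E)) * (1 - B * R) + E * (B * R) := by
    have h5 : A * (1 - B * R) = (E - W * toRows₁ (Pᴴ * E)) * (1 - B * R) := by
      conv_lhs => rw [hA]
      rw [Matrix.add_mul, Matrix.mul_assoc, hRQ, Matrix.mul_zero, zero_add]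
    have h6 : C * U * R = A * (B * R) - E * (B * R) := by
      rw [← Matrix.sub_mul, hU]
      have : A - E = C * Vᴴ := by rw [hE]; abel
      rw [this]
      simp only [Matrix.mul_assoc]
    rw [← h5, h6, Matrix.mul_sub, Matrix.mul_one]
    abel
  rw [key]
  refine (norm_add_le _ _).trans ?_
  have h7 := aux_mul_right (E - W * toRows₁ (Pᴴ * E)) _ nQ'
  have h8 := aux_mul_right E _ nQ
  linarith
end

section
/- Let A be an m×n complex matrix, P an n×n permutation matrix, and suppose A P = Q S where Q is m×r and S is r×n with r ≤ min(m,n). Partition Q = [Q₁ Q₂] with Q₁ the first k columns of Q and Q₂ the remaining r−k columns, and partition S into blocks S₁₁ (k×k, the top-left block), S₁₂ (k×(n−k), top-right), S₂₁ = 0 ((r−k)×k, bottom-left, assumed zero), and S₂₂ ((r−k)×(n−k), bottom-right). Let T be a k×(n−k) complex matrix with S₁₁ T = S₁₂, set C := Q₁ S₁₁ and Vᴴ := [I_k T] Pᴴ (a k×n matrix). Then A − C Vᴴ = Q₂ [0 S₂₂] Pᴴ; that is, the residual of the rank-k interpolative decomposition built from the pivoted QR factorization equals the truncated QR residual. -/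
open Matrix

/-- Equation (14) of the paper: correctness of the ID built from a pivoted QR factorization.
Columns of the `m × n` matrix `A` are modelled by `Fin k ⊕ Fin (n - k)` and the `r` rows of
`S` by `Fin k ⊕ Fin (r - k)`, with `r ≤ min m n` and `k ≤ r`. If `A P = Q S` with
`Q = [Q₁  Q₂]` and `S = [[S₁₁, S₁₂], [0, S₂₂]]`, `P` is a permutation matrix,
`S₁₁ T = S₁₂`, `C := Q₁ S₁₁` and `Vᴴ := [I_k  T] Pᴴ`, then
`A − C Vᴴ = Q₂ [0  S₂₂] Pᴴ`. -/
theorem id_residual_from_pivoted_qr {m n r k : ℕ} (hr : r ≤ min m n) (hk : k ≤ r)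
    (A : Matrix (Fin m) (Fin k ⊕ Fin (n - k)) ℂ)
    (P : Matrix (Fin k ⊕ Fin (n - k)) (Fin k ⊕ Fin (n - k)) ℂ)
    (hP : ∃ σ : Equiv.Perm (Fin k ⊕ Fin (n - k)), P = σ.permMatrix ℂ)
    (Q₁ : Matrix (Fin m) (Fin k) ℂ)
    (Q₂ : Matrix (Fin m) (Fin (r - k)) ℂ)
    (S₁₁ : Matrix (Fin k) (Fin k) ℂ)
    (S₁₂ : Matrix (Fin k) (Fin (n - k)) ℂ)
    (S₂₂ : Matrix (Fin (r - k)) (Fin (n - k)) ℂ)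
    (hQR : A * P =
      fromCols Q₁ Q₂ * fromBlocks S₁₁ S₁₂ (0 : Matrix (Fin (r - k)) (Fin k) ℂ) S₂₂)
    (T : Matrix (Fin k) (Fin (n - k)) ℂ)
    (hT : S₁₁ * T = S₁₂)
    (C : Matrix (Fin m) (Fin k) ℂ) (hC : C = Q₁ * S₁₁) :
    A - C * (fromCols (1 : Matrix (Fin k) (Fin k) ℂ) T * Pᴴ) =
      Q₂ * (fromCols (0 : Matrix (Fin (r - k)) (Fin k) ℂ) S₂₂ * Pᴴ) := by
  have hPP : P * Pᴴ = 1 := by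
    obtain ⟨σ, rfl⟩ := hP
    rw [Matrix.conjTranspose_permMatrix, ← Matrix.permMatrix_mul]
    simp
  have hA : A = (A * P) * Pᴴ := by
    rw [Matrix.mul_assoc, hPP, Matrix.mul_one]
  have hkey : A * P = C * fromCols (1 : Matrix (Fin k) (Fin k) ℂ) T +
      Q₂ * fromCols (0 : Matrix (Fin (r - k)) (Fin k) ℂ) S₂₂ := by
    rw [hQR, hC, ← hT, fromCols_mul_fromBlocks, mul_fromCols, mul_fromCols]
    ext i (j | j) <;> simp [Matrix.mul_assoc]
  rw [sub_eq_iff_eq_add, ← Matrix.mul_assoc, ← Matrix.mul_assoc, ← Matrix.add_mul, add_comm,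
    ← hkey]
  exact hA
end

section
/- Let S be an r×n complex upper-triangular matrix (S(i,j) = 0 for i > j) whose entries satisfy the column-pivoted QR decay condition: for all indices j < ℓ, |S(j,j)| ≥ ‖S(j:r, ℓ)‖₂ (the Euclidean norm of the portion of column ℓ from row j downward). Let k ≤ min(r,n), and let S₁₁ := S(1:k, 1:k) and S₁₂ := S(1:k, k+1:n). Then there exists a k×(n−k) complex matrix T with S₁₁ T = S₁₂. -/
open Matrix

/-- Back substitution for an upper-triangular system, where the right-hand side vanishes from
row `j` on whenever the `j`-th diagonal entry is zero. -/
lemma back_subst {k : ℕ} (A : Matrix (Fin k) (Fin k) ℂ)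
    (htri : ∀ i j : Fin k, j < i → A i j = 0) (m : ℕ) :
    ∀ b : Fin k → ℂ, (∀ j, A j j = 0 → ∀ i, j ≤ i → b i = 0) →
      (∀ i : Fin k, m ≤ (i : ℕ) → b i = 0) → ∃ t : Fin k → ℂ, A *ᵥ t = b := by
  induction m with
  | zero =>
    intro b _ hb
    refine ⟨0, ?_⟩
    ext i
    simp [hb i (Nat.zero_le _)]
  | succ m ih =>
    intro b hd hb
    by_cases hm : m < k
    swap
    · exact ih b hd (fun i hi => absurd i.isLt (by omega))
    by_cases h0 : A ⟨m, hm⟩ ⟨m, hm⟩ = 0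
    · exact ih b hd (fun i hi => hd _ h0 i hi)
    have hmain := ih (fun i => b i - A i ⟨m, hm⟩ * (b ⟨m, hm⟩ / A ⟨m, hm⟩ ⟨m, hm⟩))
      (by
        intro j hj i hji
        by_cases hjm : j ≤ ⟨m, hm⟩
        · simp [hd j hj i hji, hd j hj _ hjm]
        · simp [hd j hj i hji, htri i ⟨m, hm⟩ (lt_of_lt_of_le (not_le.mp hjm) hji)])
      (by
        intro i hi
        rcases Nat.lt_or_ge m i with h | h
        · simp [hb i h, htri i ⟨m, hm⟩ h]
        · have : i = ⟨m, hm⟩ := Fin.ext (by simp; omega)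
          rw [this, mul_div_cancel₀ _ h0, sub_self])
    obtain ⟨t, ht⟩ := hmain
    refine ⟨t + Pi.single ⟨m, hm⟩ (b ⟨m, hm⟩ / A ⟨m, hm⟩ ⟨m, hm⟩), ?_⟩
    rw [Matrix.mulVec_add, ht]
    ext i
    simp [Matrix.mulVec_single]
    ring

/-- Solvability of the system `S₁₁ T = S₁₂` arising in the interpolative decomposition.
If `S` is an `r × n` upper-triangular matrix satisfying the column-pivoted QR decay
condition `|S(j,j)| ≥ ‖S(j:r, ℓ)‖₂` for all `j < ℓ`, then for `k ≤ min(r,n)` there exists a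
`k × (n−k)` matrix `T` with `S₁₁ T = S₁₂`, where `S₁₁ = S(1:k,1:k)` and `S₁₂ = S(1:k,k+1:n)`. -/
theorem exists_T_of_pivoted_qr {r n k : ℕ} (hkr : k ≤ r) (hkn : k ≤ n)
    (S : Matrix (Fin r) (Fin n) ℂ)
    (htri : ∀ (i : Fin r) (j : Fin n), (j : ℕ) < (i : ℕ) → S i j = 0)
    (hdecay : ∀ (j : Fin r) (ℓ : Fin n) (h : (j : ℕ) < (ℓ : ℕ)),
      Real.sqrt (∑ i : Fin r, if (j : ℕ) ≤ (i : ℕ) then ‖S i ℓ‖ ^ 2 else 0) ≤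
        ‖S j ⟨(j : ℕ), h.trans ℓ.isLt⟩‖) :
    ∃ T : Matrix (Fin k) (Fin (n - k)) ℂ,
      S.submatrix (Fin.castLE hkr) (Fin.castLE hkn) * T =
        S.submatrix (Fin.castLE hkr)
          (fun j : Fin (n - k) => ⟨k + (j : ℕ), by have := j.isLt; omega⟩) := by
  have key : ∀ l : Fin (n - k), ∃ t : Fin k → ℂ,
      (S.submatrix (Fin.castLE hkr) (Fin.castLE hkn)) *ᵥ t =
        fun i => S (Fin.castLE hkr i) ⟨k + (l : ℕ), by have := l.isLt; omega⟩ := by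
    intro l
    refine back_subst _ (fun i j hij => htri _ _ hij) k _ ?_
      (fun i hi => absurd i.isLt (by omega))
    intro j hj i hji
    have h1 := hdecay (Fin.castLE hkr j) ⟨k + (l : ℕ), by have := l.isLt; omega⟩
      (by have := j.isLt; simp; omega)
    have h2 : S (Fin.castLE hkr j) ⟨((Fin.castLE hkr j : Fin r) : ℕ), by
      have := j.isLt; simp; omega⟩ = 0 := hj
    rw [h2, norm_zero] at h1
    have h3 := Real.sqrt_eq_zero'.mp (le_antisymm h1 (Real.sqrt_nonneg _))
    have h4 := Finset.single_le_sum (f := fun i : Fin r =>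
      if ((Fin.castLE hkr j : Fin r) : ℕ) ≤ (i : ℕ) then
        ‖S i ⟨k + (l : ℕ), by have := l.isLt; omega⟩‖ ^ 2 else 0)
      (fun i _ => by split_ifs <;> positivity) (Finset.mem_univ (Fin.castLE hkr i))
    have h5 := h4.trans h3
    have h6 : ((Fin.castLE hkr j : Fin r) : ℕ) ≤ ((Fin.castLE hkr i : Fin r) : ℕ) := hji
    simp only [if_pos h6] at h5
    exact norm_eq_zero.mp (pow_eq_zero_iff two_ne_zero |>.mp (le_antisymm h5 (by positivity)))
  choose t ht using key
  refine ⟨Matrix.of fun i l => t l i, ?_⟩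
  ext i l
  exact congrFun (ht l) i
end
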